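/- Let U be a multivalued process on a complete metric space X possessing a pullback attractor A = {A(t)}, and assume U is forward asymptotically compact. Then the following are equivalent: (i) ω_f(B,t₀) ⊆ ω₀(A) for every bounded set B and every t₀ ∈ ℝ; (ii) ω_f(B,t₀) ⊆ ω(A) for every bounded set B and every t₀ ∈ ℝ, and dist_H(A(t), ω(A)) → 0 as t → +∞. -/

import Mathlib

open Filter Topology Set Metric Bornology ENNReal

variable {X : Type*} [MetricSpace X]

/-- Hausdorff semidistance `dist(A,B) = sup_{a ∈ A} inf_{b ∈ B} d(a,b)`,
valued in `ℝ≥0∞`. -/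
noncomputable def esemidist (A B : Set X) : ℝ≥0∞ :=
  ⨆ a : A, EMetric.infEdist (a : X) B

/-- Hausdorff distance `dist_H(A,B) = max{dist(A,B), dist(B,A)}`. -/
noncomputable def ehdist (A B : Set X) : ℝ≥0∞ :=
  max (esemidist A B) (esemidist B A)

/-- Image of a set `B` under a multivalued map `U(t,s,·)`. -/
def MImage (U : ℝ → ℝ → X → Set X) (t s : ℝ) (B : Set X) : Set X :=
  ⋃ x ∈ B, U t s x

/-- A multivalued process on `X`: `U(s,s,x) = {x}`, each value is nonempty and
`U(t,s,x) ⊆ U(t,τ,U(τ,s,x))` for `s ≤ τ ≤ t`. -/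
def IsMultiProcess (U : ℝ → ℝ → X → Set X) : Prop :=
  (∀ (s : ℝ) (x : X), U s s x = {x}) ∧
  (∀ (t s : ℝ) (x : X), s ≤ t → (U t s x).Nonempty) ∧
  (∀ (t τ s : ℝ) (x : X), s ≤ τ → τ ≤ t → U t s x ⊆ MImage U t τ (U τ s x))

/-- The multivalued process `U` is forward asymptotically compact. -/
def MFwdAsympCompact (U : ℝ → ℝ → X → Set X) : Prop :=
  ∀ (t₀ : ℝ) (B : Set X), IsBounded B →
    ∀ (t : ℕ → ℝ) (y : ℕ → X), Tendsto t atTop atTop →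
      (∀ n, t₀ ≤ t n ∧ y n ∈ MImage U (t n) t₀ B) →
      ∃ (φ : ℕ → ℕ) (z : X), StrictMono φ ∧ Tendsto (y ∘ φ) atTop (𝓝 z)

/-- Forward ω-limit set `ω_f(B,t₀)` of a set `B` for initial time `t₀`. -/
def MomegaF (U : ℝ → ℝ → X → Set X) (B : Set X) (t₀ : ℝ) : Set X :=
  {y | ∃ (t : ℕ → ℝ) (yn : ℕ → X), Tendsto t atTop atTop ∧
        (∀ n, t₀ ≤ t n ∧ yn n ∈ MImage U (t n) t₀ B) ∧ Tendsto yn atTop (𝓝 y)}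

/-- ω-limit set `ω(K)` of a family of sets `K = {K(t)}`. -/
def omegaFam (K : ℝ → Set X) : Set X :=
  {y | ∃ (t : ℕ → ℝ) (yn : ℕ → X), Tendsto t atTop atTop ∧
        (∀ n, yn n ∈ K (t n)) ∧ Tendsto yn atTop (𝓝 y)}

/-- The set `ω₀(K) = Liminf_{t → +∞} K(t)`. -/
def omega0Fam (K : ℝ → Set X) : Set X :=
  {y | Tendsto (fun t => EMetric.infEdist y (K t)) atTop (𝓝 0)}

/-- The family `C = {C(t)}` pullback attracts every bounded set. -/
def MPullbackAttracts (U : ℝ → ℝ → X → Set X) (C : ℝ → Set X) : Prop :=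
  ∀ (t : ℝ) (B : Set X), IsBounded B →
    Tendsto (fun t₀ => esemidist (MImage U t t₀ B) (C t)) atBot (𝓝 0)

/-- A pullback attractor for a multivalued process: a family of nonempty compact
negatively invariant sets which pullback attracts every bounded set and is
minimal among closed pullback attracting families. -/
def MIsPullbackAttractor (U : ℝ → ℝ → X → Set X) (A : ℝ → Set X) : Prop :=
  (∀ t, (A t).Nonempty) ∧ (∀ t, IsCompact (A t)) ∧
  (∀ t s : ℝ, s ≤ t → A t ⊆ MImage U t s (A s)) ∧
  MPullbackAttracts U A ∧
  (∀ C : ℝ → Set X, (∀ t, IsClosed (C t)) → MPullbackAttracts U C → ∀ t, A t ⊆ C t)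

/-- The family `A = {A(t)}` forward attracts every bounded set. -/
def MForwardAttracts (U : ℝ → ℝ → X → Set X) (A : ℝ → Set X) : Prop :=
  ∀ (t₀ : ℝ) (B : Set X), IsBounded B →
    Tendsto (fun t => esemidist (MImage U t t₀ B) (A t)) atTop (𝓝 0)

/-- A forward attractor for a multivalued process: a family of nonempty compact
negatively invariant sets which forward attracts every bounded set. -/
def MIsForwardAttractor (U : ℝ → ℝ → X → Set X) (A : ℝ → Set X) : Prop :=
  (∀ t, (A t).Nonempty) ∧ (∀ t, IsCompact (A t)) ∧
  (∀ t s : ℝ, s ≤ t → A t ⊆ MImage U t s (A s)) ∧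
  MForwardAttracts U A

theorem infEdist_le_esemidist {A B : Set X} {a : X} (ha : a ∈ A) :
    EMetric.infEdist a B ≤ esemidist A B :=
  le_iSup (fun a : A => EMetric.infEdist (a : X) B) ⟨a, ha⟩

/-- Sequential criterion for the Hausdorff semidistance of two families to vanish at `+∞`. -/
theorem tendsto_esemidist_zero_of_seq {K L : ℝ → Set X}
    (h : ∀ (t : ℕ → ℝ) (y : ℕ → X), Tendsto t atTop atTop → (∀ n, y n ∈ K (t n)) →
      ∃ φ : ℕ → ℕ, Tendsto (fun n => EMetric.infEdist (y (φ n)) (L (t (φ n)))) atTop (𝓝 0)) :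
    Tendsto (fun t => esemidist (K t) (L t)) atTop (𝓝 0) := by
  rw [ENNReal.tendsto_nhds_zero]
  intro ε hε
  by_contra hne
  obtain ⟨t, ht, hlt⟩ := exists_seq_forall_of_frequently (not_eventually.mp hne)
  have hy : ∀ n, ∃ y ∈ K (t n), ε < EMetric.infEdist y (L (t n)) := fun n => by
    obtain ⟨⟨y, hy⟩, hlt⟩ := lt_iSup_iff.mp (not_le.mp (hlt n))
    exact ⟨y, hy, hlt⟩
  choose y hyK hyL using hy
  obtain ⟨φ, hφ⟩ := h t y ht hyK
  obtain ⟨n, hn⟩ := (hφ.eventually_lt_const hε).exists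
  exact (hyL (φ n)).not_gt hn

theorem tendsto_ehdist_zero {K L : ℝ → Set X}
    (h₁ : Tendsto (fun t => esemidist (K t) (L t)) atTop (𝓝 0))
    (h₂ : Tendsto (fun t => esemidist (L t) (K t)) atTop (𝓝 0)) :
    Tendsto (fun t => ehdist (K t) (L t)) atTop (𝓝 0) := by
  simpa only [ehdist, max_self] using h₁.max h₂

theorem omega0Fam_subset_omegaFam {K : ℝ → Set X} (hne : ∀ t, (K t).Nonempty)
    (hc : ∀ t, IsCompact (K t)) : omega0Fam K ⊆ omegaFam K := by
  intro y hy
  choose a haK ha using fun n : ℕ => (hc n).exists_infEDist_eq_edist (hne n) y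
  refine ⟨fun n => n, a, tendsto_natCast_atTop_atTop, haK, ?_⟩
  rw [tendsto_iff_edist_tendsto_0]
  refine (Tendsto.comp hy tendsto_natCast_atTop_atTop).congr fun n => ?_
  exact (ha n).trans (edist_comm _ _)

/-- In a forward asymptotically compact process, a negatively invariant family that is bounded
at time `0` is asymptotically sequentially compact. -/
theorem MFwdAsympCompact.exists_subseq_tendsto {U : ℝ → ℝ → X → Set X}
    (hFC : MFwdAsympCompact U) {K : ℝ → Set X} (hb : IsBounded (K 0))
    (hinv : ∀ t s : ℝ, s ≤ t → K t ⊆ MImage U t s (K s)) {t : ℕ → ℝ} {y : ℕ → X}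
    (ht : Tendsto t atTop atTop) (hy : ∀ n, y n ∈ K (t n)) :
    ∃ φ : ℕ → ℕ, StrictMono φ ∧ ∃ z ∈ omegaFam K, Tendsto (y ∘ φ) atTop (𝓝 z) := by
  obtain ⟨ψ, hψ, hpos⟩ := extraction_of_eventually_atTop (ht.eventually_ge_atTop 0)
  have htψ := ht.comp hψ.tendsto_atTop
  obtain ⟨φ, z, hφ, hz⟩ := hFC 0 (K 0) hb (t ∘ ψ) (y ∘ ψ) htψ
    fun n => ⟨hpos n, hinv _ _ (hpos n) (hy _)⟩
  exact ⟨ψ ∘ φ, hψ.comp hφ, z,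
    ⟨_, _, htψ.comp hφ.tendsto_atTop, fun n => hy (ψ (φ n)), hz⟩, hz⟩

theorem omegaFam_subset_MomegaF {U : ℝ → ℝ → X → Set X} {K : ℝ → Set X}
    (hinv : ∀ t s : ℝ, s ≤ t → K t ⊆ MImage U t s (K s)) (t₀ : ℝ) :
    omegaFam K ⊆ MomegaF U (K t₀) t₀ := by
  rintro z ⟨t, y, ht, hy, hz⟩
  obtain ⟨ψ, hψ, hpos⟩ := extraction_of_eventually_atTop (ht.eventually_ge_atTop t₀)
  exact ⟨t ∘ ψ, y ∘ ψ, ht.comp hψ.tendsto_atTop,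
    fun n => ⟨hpos n, hinv _ _ (hpos n) (hy _)⟩, hz.comp hψ.tendsto_atTop⟩

theorem exists_mem_edist_lt_of_mem_omegaFam {K : ℝ → Set X} {w : X} (hw : w ∈ omegaFam K)
    (T : ℝ) {ε : ℝ≥0∞} (hε : 0 < ε) : ∃ s ≥ T, ∃ v ∈ K s, edist w v < ε := by
  obtain ⟨t, y, ht, hy, hlim⟩ := hw
  obtain ⟨n, hn, hn'⟩ := ((ht.eventually_ge_atTop T).and
    ((tendsto_iff_edist_tendsto_0.mp hlim).eventually_lt_const hε)).exists
  exact ⟨t n, hn, y n, hy n, by rwa [edist_comm]⟩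

/-- `ω(K)` is sequentially compact as soon as `K` is asymptotically sequentially compact. -/
theorem MFwdAsympCompact.exists_subseq_tendsto_omegaFam {U : ℝ → ℝ → X → Set X}
    (hFC : MFwdAsympCompact U) {K : ℝ → Set X} (hb : IsBounded (K 0))
    (hinv : ∀ t s : ℝ, s ≤ t → K t ⊆ MImage U t s (K s)) {w : ℕ → X}
    (hw : ∀ n, w n ∈ omegaFam K) :
    ∃ φ : ℕ → ℕ, StrictMono φ ∧ ∃ z ∈ omegaFam K, Tendsto (w ∘ φ) atTop (𝓝 z) := by
  choose s hs v hv hwv using fun n : ℕ => exists_mem_edist_lt_of_mem_omegaFam (hw n) n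
    (ENNReal.inv_pos.mpr (ENNReal.natCast_ne_top n))
  obtain ⟨φ, hφ, z, hz, hvz⟩ := hFC.exists_subseq_tendsto hb hinv
    (tendsto_atTop_mono hs tendsto_natCast_atTop_atTop) hv
  refine ⟨φ, hφ, z, hz, ?_⟩
  rw [tendsto_iff_edist_tendsto_0] at hvz ⊢
  have hsum := (ENNReal.tendsto_inv_nat_nhds_zero.comp hφ.tendsto_atTop).add hvz
  rw [add_zero] at hsum
  exact tendsto_of_tendsto_of_tendsto_of_le_of_le tendsto_const_nhds hsum (fun _ => zero_le)
    fun n => (edist_triangle _ (v (φ n)) _).trans (add_le_add_left (hwv (φ n)).le _)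

/-- For a forward asymptotically compact multivalued process `U`
with pullback attractor `A`: `ω_f(B,t₀) ⊆ ω₀(A)` for all bounded `B` and all
`t₀` iff `ω_f(B,t₀) ⊆ ω(A)` for all bounded `B` and all `t₀` and
`dist_H(A(t), ω(A)) → 0` as `t → +∞`. -/
theorem mOmega0_condition_iff [CompleteSpace X]
    (U : ℝ → ℝ → X → Set X) (hU : IsMultiProcess U)
    (A : ℝ → Set X) (hA : MIsPullbackAttractor U A)
    (hFC : MFwdAsympCompact U) :
    (∀ B : Set X, IsBounded B → ∀ t₀ : ℝ, MomegaF U B t₀ ⊆ omega0Fam A) ↔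
      ((∀ B : Set X, IsBounded B → ∀ t₀ : ℝ, MomegaF U B t₀ ⊆ omegaFam A) ∧
        Tendsto (fun t => ehdist (A t) (omegaFam A)) atTop (𝓝 0)) := by
  obtain ⟨hne, hc, hinv, -, -⟩ := hA
  have hb := (hc 0).isBounded
  refine ⟨fun h => ⟨fun B hB t₀ => (h B hB t₀).trans (omega0Fam_subset_omegaFam hne hc),
    tendsto_ehdist_zero ?_ ?_⟩, fun ⟨hsub, hlim⟩ B hB t₀ y hy => ?_⟩
  · refine tendsto_esemidist_zero_of_seq fun t y ht hy => ?_
    obtain ⟨φ, -, z, hz, hyz⟩ := hFC.exists_subseq_tendsto hb hinv ht hy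
    refine ⟨φ, tendsto_of_tendsto_of_tendsto_of_le_of_le tendsto_const_nhds
      (tendsto_iff_edist_tendsto_0.mp hyz) (fun _ => zero_le) fun n => ?_⟩
    exact infEDist_le_edist_of_mem hz
  · refine tendsto_esemidist_zero_of_seq fun t w ht hw => ?_
    obtain ⟨φ, hφ, z, hz, hwz⟩ := hFC.exists_subseq_tendsto_omegaFam hb hinv hw
    have hz₀ : z ∈ omega0Fam A := h _ hb 0 (omegaFam_subset_MomegaF hinv 0 hz)
    have hsum := (Tendsto.comp hz₀ (ht.comp hφ.tendsto_atTop)).add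
      (tendsto_iff_edist_tendsto_0.mp hwz)
    rw [add_zero] at hsum
    exact ⟨φ, tendsto_of_tendsto_of_tendsto_of_le_of_le tendsto_const_nhds hsum
      (fun _ => zero_le) fun n => infEDist_le_infEDist_add_edist⟩
  · exact tendsto_of_tendsto_of_tendsto_of_le_of_le tendsto_const_nhds hlim
      (fun _ => zero_le) fun t =>
        (infEdist_le_esemidist (hsub B hB t₀ hy)).trans (le_max_right _ _)
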